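/- arXiv:1110.6240 — 8 statements merged into one kernel-verified Lean document; each statement's English description precedes it below -/
import Mathlib

section
/- Let T ∈ (0,∞], let a : [0,T) → ℝ be continuously differentiable with a(t) ≥ a₀ for some constant a₀ > 0 and all t ∈ [0,T), let b : [0,T) → ℝ be continuous, and let c > 0. Suppose Y : [0,T) → ℝ is twice continuously differentiable and satisfies a(t)·Y''(t) + b(t)·Y'(t) − c·Y(t) ≥ 0 for all t ∈ [0,T), with Y(0) > 0 and Y'(0) > 0. Then Y'(t) > 0 for all t ∈ [0,T). -/
open Set Filter Topology

/-- Lemma 3.1 (L1): if `a(t) Y'' + b(t) Y' - c Y ≥ 0` on `[0,T)` with `a ≥ a₀ > 0`,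
`b` continuous, `c > 0`, `Y(0) > 0` and `Y'(0) > 0`, then `Y' > 0` on `[0,T)`. -/
theorem stmt_0 (T : EReal) (hT : 0 < T)
    (a a' b Y Y' Y'' : ℝ → ℝ) (a₀ c : ℝ) (ha₀ : 0 < a₀)
    (ha_deriv : ∀ t : ℝ, 0 ≤ t → (t : EReal) < T → HasDerivAt a (a' t) t)
    (ha'_cont : ContinuousOn a' {t : ℝ | 0 ≤ t ∧ (t : EReal) < T})
    (ha_lb : ∀ t : ℝ, 0 ≤ t → (t : EReal) < T → a₀ ≤ a t)
    (hb_cont : ContinuousOn b {t : ℝ | 0 ≤ t ∧ (t : EReal) < T})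
    (hc : 0 < c)
    (hY1 : ∀ t : ℝ, 0 ≤ t → (t : EReal) < T → HasDerivAt Y (Y' t) t)
    (hY2 : ∀ t : ℝ, 0 ≤ t → (t : EReal) < T → HasDerivAt Y' (Y'' t) t)
    (hY''_cont : ContinuousOn Y'' {t : ℝ | 0 ≤ t ∧ (t : EReal) < T})
    (hineq : ∀ t : ℝ, 0 ≤ t → (t : EReal) < T →
      0 ≤ a t * Y'' t + b t * Y' t - c * Y t)
    (hY0 : 0 < Y 0) (hY'0 : 0 < Y' 0) :
    ∀ t : ℝ, 0 ≤ t → (t : EReal) < T → 0 < Y' t := by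
  intro t ht htT
  by_contra! hneg
  have hlt : ∀ s : ℝ, s ≤ t → (s : EReal) < T := fun s hs =>
    lt_of_le_of_lt (EReal.coe_le_coe_iff.mpr hs) htT
  have hcont : ContinuousOn Y' (Icc 0 t) := fun s hs =>
    (hY2 s hs.1 (hlt s hs.2)).continuousAt.continuousWithinAt
  have hcompact : IsCompact (Icc 0 t ∩ Y' ⁻¹' Iic 0) :=
    isCompact_Icc.of_isClosed_subset
      (hcont.preimage_isClosed_of_isClosed isClosed_Icc isClosed_Iic) inter_subset_left
  obtain ⟨τ, ⟨⟨hτ0, hτt⟩, hτneg⟩, hτmin⟩ :=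
    hcompact.exists_isLeast ⟨t, ⟨ht, le_rfl⟩, hneg⟩
  have hτneg : Y' τ ≤ 0 := hτneg
  have hτpos : 0 < τ := hτ0.lt_of_ne (by rintro rfl; linarith)
  have hpos : ∀ s, 0 ≤ s → s < τ → 0 < Y' s := fun s hs hsτ => by
    by_contra! h
    exact absurd (hτmin ⟨⟨hs, hsτ.le.trans hτt⟩, h⟩) (not_le.mpr hsτ)
  have hτT := hlt τ hτt
  have hleft : ∀ᶠ s in 𝓝[<] τ, 0 < Y' s := by
    filter_upwards [Ioo_mem_nhdsLT hτpos] with s hs using hpos s hs.1.le hs.2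
  have hzero : Y' τ = 0 := le_antisymm hτneg <|
    ge_of_tendsto ((hY2 τ hτ0 hτT).continuousAt.tendsto.mono_left nhdsWithin_le_nhds)
      (hleft.mono fun _ h => h.le)
  have hYτ : 0 < Y τ := by
    obtain ⟨s, hs, hslope⟩ := exists_hasDerivAt_eq_slope Y Y' hτpos
      (fun s hs => (hY1 s hs.1 (hlt s (hs.2.trans hτt))).continuousAt.continuousWithinAt)
      (fun s hs => hY1 s hs.1.le (hlt s (hs.2.le.trans hτt)))
    have h := hpos s hs.1.le hs.2
    rw [hslope, sub_zero, div_pos_iff_of_pos_right hτpos] at h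
    linarith
  have hY''pos : 0 < Y'' τ := by
    have h := hineq τ hτ0 hτT
    rw [hzero, mul_zero, add_zero] at h
    have haτ : 0 < a τ := ha₀.trans_le (ha_lb τ hτ0 hτT)
    exact pos_of_mul_pos_right (by linarith [mul_pos hc hYτ]) haτ.le
  have hslope : ∀ᶠ s in 𝓝[<] τ, 0 < slope Y' τ s :=
    (((hasDerivAt_iff_tendsto_slope.mp (hY2 τ hτ0 hτT)).eventually_const_lt hY''pos)).filter_mono
      (nhdsWithin_mono τ fun _ h => ne_of_lt h)
  obtain ⟨s, hs, hsY, hsτ⟩ := (hslope.and (hleft.and self_mem_nhdsWithin)).exists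
  rw [slope_def_field, hzero, sub_zero] at hs
  exact absurd hs <| not_lt.mpr <|
    div_nonpos_of_nonneg_of_nonpos hsY.le (sub_nonpos.mpr (le_of_lt hsτ))
end

section
/- Let T ∈ (0,∞], let a : [0,T) → ℝ be continuously differentiable with a(t) ≥ a₀ for some constant a₀ > 0 and all t ∈ [0,T), let b : [0,T) → ℝ be continuous, and let c > 0. Suppose Y : [0,T) → ℝ is twice continuously differentiable and satisfies a(t)·Y''(t) + b(t)·Y'(t) − c·Y(t) ≥ 0 for all t ∈ [0,T), with Y(0) > 0 and Y'(0) > 0. Then Y(t) > Y(0) for all t ∈ (0,T). -/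
open Filter Topology in
/-- A function with positive derivative at `x` exceeds its value at `x` just to the right. -/
theorem HasDerivAt.eventually_lt_nhdsGT_of_pos {f : ℝ → ℝ} {f' x : ℝ}
    (hf : HasDerivAt f f' x) (hf' : 0 < f') : ∀ᶠ y in 𝓝[>] x, f x < f y := by
  have h := (hasDerivAt_iff_tendsto_slope.mp hf).eventually (lt_mem_nhds hf')
  have hle : 𝓝[>] x ≤ 𝓝[≠] x := nhdsWithin_mono x fun y (hy : x < y) => hy.ne'
  filter_upwards [hle h, self_mem_nhdsWithin] with y hy hxy
  have hxy' : x < y := hxy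
  rw [slope_def_field] at hy
  exact sub_pos.mp ((div_pos_iff_of_pos_right (sub_pos.mpr hxy')).mp hy)


/-- Consequence of Lemma 3.1 (inequality (Wpos)): under the same hypotheses,
`Y(t) > Y(0)` for all `t ∈ (0,T)`. -/
theorem stmt_1 (T : EReal) (hT : 0 < T)
    (a a' b Y Y' Y'' : ℝ → ℝ) (a₀ c : ℝ) (ha₀ : 0 < a₀)
    (ha_deriv : ∀ t : ℝ, 0 ≤ t → (t : EReal) < T → HasDerivAt a (a' t) t)
    (ha'_cont : ContinuousOn a' {t : ℝ | 0 ≤ t ∧ (t : EReal) < T})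
    (ha_lb : ∀ t : ℝ, 0 ≤ t → (t : EReal) < T → a₀ ≤ a t)
    (hb_cont : ContinuousOn b {t : ℝ | 0 ≤ t ∧ (t : EReal) < T})
    (hc : 0 < c)
    (hY1 : ∀ t : ℝ, 0 ≤ t → (t : EReal) < T → HasDerivAt Y (Y' t) t)
    (hY2 : ∀ t : ℝ, 0 ≤ t → (t : EReal) < T → HasDerivAt Y' (Y'' t) t)
    (hY''_cont : ContinuousOn Y'' {t : ℝ | 0 ≤ t ∧ (t : EReal) < T})
    (hineq : ∀ t : ℝ, 0 ≤ t → (t : EReal) < T →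
      0 ≤ a t * Y'' t + b t * Y' t - c * Y t)
    (hY0 : 0 < Y 0) (hY'0 : 0 < Y' 0) :
    ∀ t : ℝ, 0 < t → (t : EReal) < T → Y 0 < Y t := by
  intro t ht htT
  by_contra! hle
  have hT' : ∀ s ≤ t, (s : EReal) < T := fun s hs =>
    lt_of_le_of_lt (EReal.coe_le_coe_iff.mpr hs) htT
  have hcont : ContinuousOn Y (Set.Icc 0 t) := fun s hs =>
    (hY1 s hs.1 (hT' s hs.2)).continuousAt.continuousWithinAt
  obtain ⟨s, hs, hmax⟩ := isCompact_Icc.exists_isMaxOn (Set.nonempty_Icc.mpr ht.le) hcont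
  have hmax' : ∀ y, 0 ≤ y → y ≤ t → Y y ≤ Y s := fun y h0 h1 => hmax ⟨h0, h1⟩
  have h0s : Y 0 < Y s := by
    obtain ⟨y, hy, hy0, hyt⟩ := (((hY1 0 le_rfl (hT' 0 ht.le)).eventually_lt_nhdsGT_of_pos
      hY'0).and (Ioc_mem_nhdsGT ht)).exists
    exact hy.trans_le (hmax' y hy0.le hyt)
  have hs0 : 0 < s := hs.1.lt_of_ne fun h => by simp [← h] at h0s
  have hst : s < t := hs.2.lt_of_ne fun h => by rw [h] at h0s; linarith
  have hsT := hT' s hs.2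
  have hY's : Y' s = 0 :=
    (hmax.isLocalMax (Icc_mem_nhds hs0 hst)).hasDerivAt_eq_zero (hY1 s hs.1 hsT)
  have hY''s : 0 < Y'' s := by
    have hi := hineq s hs.1 hsT
    rw [hY's] at hi
    have hcY : 0 < c * Y s := mul_pos hc (hY0.trans h0s)
    exact pos_of_mul_pos_right (by linarith : 0 < a s * Y'' s)
      (ha₀.le.trans (ha_lb s hs.1 hsT))
  have hev := (hY2 s hs.1 hsT).eventually_lt_nhdsGT_of_pos hY''s
  obtain ⟨u, hu, hsub⟩ := mem_nhdsGT_iff_exists_Ioo_subset.mp hev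
  have hsu : s < min u t := lt_min hu hst
  obtain ⟨ξ, hξ, heq⟩ := exists_hasDerivAt_eq_slope Y Y' hsu
    (hcont.mono (Set.Icc_subset_Icc hs.1 (min_le_right u t)))
    fun x hx => hY1 x (hs0.trans hx.1).le (hT' x (hx.2.le.trans (min_le_right u t)))
  have hpos : Y' s < Y' ξ := hsub ⟨hξ.1, hξ.2.trans_le (min_le_left u t)⟩
  rw [hY's, heq, div_pos_iff_of_pos_right (sub_pos.mpr hsu)] at hpos
  linarith [hmax' (min u t) (hs0.trans hsu).le (min_le_right u t)]
end

section
/- Let T ∈ (0,∞], let a : [0,T) → ℝ be continuously differentiable with a(t) ≥ a₀ > 0 and a'(t) > 0 for all t ∈ [0,T), let b : [0,T) → ℝ be continuous with |b(t)| ≤ M for all t and some M ≥ 0, set B = M/a₀, and let c > 0. Suppose Y : [0,T) → ℝ is twice continuously differentiable and satisfies a(t)·Y''(t) + b(t)·Y'(t) − c·Y(t) ≥ 0 for all t ∈ [0,T), with Y(0) > 0 and Y'(0) ≥ (√(c/a(0) + B²) − B)·Y(0). Then for all t ∈ [0,T), Y(t) ≥ Y(0)·exp(∫₀ᵗ (−B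 + √(c/a(s) + B²)) ds). -/
open Set Filter Topology

/-- A function with positive derivative at `x` exceeds its value at `x` just to the right. -/
theorem HasDerivAt.eventually_lt_nhdsGT {f : ℝ → ℝ} {f' x : ℝ} (hf : HasDerivAt f f' x)
    (hf' : 0 < f') : ∀ᶠ z in 𝓝[>] x, f x < f z := by
  have h := (hasDerivWithinAt_iff_tendsto_slope' (s := Ioi x) self_notMem_Ioi).1
    hf.hasDerivWithinAt
  filter_upwards [h.eventually (lt_mem_nhds hf'), self_mem_nhdsWithin] with z hz hxz
  rw [slope_def_field] at hz
  have hpos : 0 < z - x := sub_pos.2 hxz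
  exact sub_pos.1 ((div_pos_iff_of_pos_right hpos).1 hz)

/-- The growth rate `-B + √(c / a + B²)` is strictly decreasing along an increasing
coefficient `a`, at the level of derivatives. -/
theorem exists_hasDerivAt_growthRate_neg {a : ℝ → ℝ} {a' B c x : ℝ} (hc : 0 < c)
    (ha : HasDerivAt a a' x) (hax : 0 < a x) (ha' : 0 < a') :
    ∃ l' < 0, HasDerivAt (fun s => -B + Real.sqrt (c / a s + B ^ 2)) l' x := by
  have hpos : 0 < c / a x + B ^ 2 := by positivity
  have h := ((((hasDerivAt_const x c).fun_div ha hax.ne').add_const (B ^ 2)).sqrt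
    hpos.ne').const_add (-B)
  refine ⟨_, ?_, h⟩
  refine div_neg_of_neg_of_pos (div_neg_of_neg_of_pos ?_ (by positivity)) (by positivity)
  nlinarith [mul_pos hc ha']

/-- The growth rate `l = -B + √(c / α + B²)` is the positive root of `l² + 2 B l = c / α`. -/
theorem growthRate_pos_and_quadratic {α B c : ℝ} (hα : 0 < α) (hc : 0 < c) :
    0 < -B + Real.sqrt (c / α + B ^ 2) ∧
      α * ((-B + Real.sqrt (c / α + B ^ 2)) ^ 2 + 2 * B * (-B + Real.sqrt (c / α + B ^ 2)))
        = c := by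
  have hq : 0 < c / α := by positivity
  constructor
  · have := Real.lt_sqrt_of_sq_lt (show B ^ 2 < c / α + B ^ 2 by linarith)
    linarith
  · have hs := Real.sq_sqrt (show 0 ≤ c / α + B ^ 2 by positivity)
    have : (-B + Real.sqrt (c / α + B ^ 2)) ^ 2 + 2 * B * (-B + Real.sqrt (c / α + B ^ 2))
        = c / α := by linear_combination hs
    rw [this, mul_div_cancel₀ _ hα.ne']

/-- At a point where `y' = l y` with `y > 0`, the differential inequality
`α y'' + β y' - c y ≥ 0` forces `y'' ≥ l y'`. -/
theorem mul_le_of_differential_inequality {α α₀ β M B c l y y' y'' : ℝ} (hα₀ : 0 < α₀)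
    (hα : α₀ ≤ α) (hβ : |β| ≤ M) (hM : 0 ≤ M) (hB : B = M / α₀) (hl : 0 < l)
    (hquad : α * (l ^ 2 + 2 * B * l) = c) (hy : 0 < y) (hy' : y' = l * y)
    (h : 0 ≤ α * y'' + β * y' - c * y) : l * y' ≤ y'' := by
  have hα_pos : 0 < α := hα₀.trans_le hα
  have hB_nonneg : 0 ≤ B := hB ▸ div_nonneg hM hα₀.le
  have hMB : M ≤ α * B := by
    rw [show M = α₀ * B by rw [hB, mul_div_cancel₀ _ hα₀.ne']]
    exact mul_le_mul_of_nonneg_right hα hB_nonneg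
  have hly : 0 < l * y := mul_pos hl hy
  have hβy : β * (l * y) ≤ α * B * (l * y) :=
    mul_le_mul_of_nonneg_right (((le_abs_self β).trans hβ).trans hMB) hly.le
  have hBly : 0 ≤ α * B * (l * y) := by positivity
  subst hy' hquad
  refine le_of_mul_le_mul_left ?_ hα_pos
  linarith


/-- Lemma 3.2 (L2var): with `a` increasing and bounded below, `|b| ≤ M`, `B = M/a₀`,
and suitable initial data, `Y(t) ≥ Y(0) exp(∫₀ᵗ (-B + √(c/a(s) + B²)) ds)`. -/
theorem stmt_2 (T : EReal) (hT : 0 < T)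
    (a a' b Y Y' Y'' : ℝ → ℝ) (a₀ M B c : ℝ) (ha₀ : 0 < a₀) (hM : 0 ≤ M)
    (hB : B = M / a₀)
    (ha_deriv : ∀ t : ℝ, 0 ≤ t → (t : EReal) < T → HasDerivAt a (a' t) t)
    (ha'_cont : ContinuousOn a' {t : ℝ | 0 ≤ t ∧ (t : EReal) < T})
    (ha_lb : ∀ t : ℝ, 0 ≤ t → (t : EReal) < T → a₀ ≤ a t)
    (ha'_pos : ∀ t : ℝ, 0 ≤ t → (t : EReal) < T → 0 < a' t)
    (hb_cont : ContinuousOn b {t : ℝ | 0 ≤ t ∧ (t : EReal) < T})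
    (hb_bd : ∀ t : ℝ, 0 ≤ t → (t : EReal) < T → |b t| ≤ M)
    (hc : 0 < c)
    (hY1 : ∀ t : ℝ, 0 ≤ t → (t : EReal) < T → HasDerivAt Y (Y' t) t)
    (hY2 : ∀ t : ℝ, 0 ≤ t → (t : EReal) < T → HasDerivAt Y' (Y'' t) t)
    (hY''_cont : ContinuousOn Y'' {t : ℝ | 0 ≤ t ∧ (t : EReal) < T})
    (hineq : ∀ t : ℝ, 0 ≤ t → (t : EReal) < T →
      0 ≤ a t * Y'' t + b t * Y' t - c * Y t)
    (hY0 : 0 < Y 0)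
    (hY'0 : (Real.sqrt (c / a 0 + B ^ 2) - B) * Y 0 ≤ Y' 0) :
    ∀ t : ℝ, 0 ≤ t → (t : EReal) < T →
      Y 0 * Real.exp (∫ s in (0:ℝ)..t, (-B + Real.sqrt (c / a s + B ^ 2))) ≤ Y t := by
  intro t ht htT
  have hlt : ∀ s ∈ Icc 0 t, (s : EReal) < T := fun s hs =>
    (EReal.coe_le_coe_iff.2 hs.2).trans_lt htT
  have ha_pos : ∀ s ∈ Icc 0 t, 0 < a s := fun s hs => ha₀.trans_le (ha_lb s hs.1 (hlt s hs))
  set l : ℝ → ℝ := fun s => -B + Real.sqrt (c / a s + B ^ 2) with hl_def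
  have hl : ∀ s ∈ Icc 0 t, 0 < l s ∧ a s * (l s ^ 2 + 2 * B * l s) = c := fun s hs =>
    growthRate_pos_and_quadratic (ha_pos s hs) hc
  have hl_deriv : ∀ s ∈ Icc 0 t, ∃ l' < 0, HasDerivAt l l' s := fun s hs =>
    exists_hasDerivAt_growthRate_neg hc (ha_deriv s hs.1 (hlt s hs)) (ha_pos s hs)
      (ha'_pos s hs.1 (hlt s hs))
  have hl_cont : ContinuousOn l (Icc 0 t) := fun s hs =>
    let ⟨_, _, h⟩ := hl_deriv s hs
    h.continuousAt.continuousWithinAt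
  have hY_cont : ContinuousOn Y (Icc 0 t) := fun s hs =>
    (hY1 s hs.1 (hlt s hs)).continuousAt.continuousWithinAt
  have hY'_cont : ContinuousOn Y' (Icc 0 t) := fun s hs =>
    (hY2 s hs.1 (hlt s hs)).continuousAt.continuousWithinAt
  have hmain : Icc 0 t ⊆ {s | l s * Y s ≤ Y' s ∧ Y 0 ≤ Y s} := by
    refine IsClosed.Icc_subset_of_forall_mem_nhdsWithin ?_ ?_ ?_
    · have h₁ := isClosed_Icc.isClosed_le (hl_cont.mul hY_cont) hY'_cont
      have h₂ := isClosed_Icc.isClosed_le (continuousOn_const (c := Y 0)) hY_cont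
      convert h₁.inter h₂ using 1
      ext s
      simp only [mem_inter_iff, mem_ofPred_eq, Pi.mul_apply]
      tauto
    · refine ⟨?_, le_rfl⟩
      have : l 0 = Real.sqrt (c / a 0 + B ^ 2) - B := by simp only [hl_def]; ring
      rwa [this]
    · rintro x ⟨⟨hxw, hxY⟩, hx⟩
      have hx : x ∈ Icc 0 t := Ico_subset_Icc_self hx
      have hYx : 0 < Y x := hY0.trans_le hxY
      obtain ⟨hlx, hquad⟩ := hl x hx
      obtain ⟨l', hl', hld⟩ := hl_deriv x hx
      have hY'x : 0 < Y' x := (mul_pos hlx hYx).trans_le hxw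
      have hYd := hY1 x hx.1 (hlt x hx)
      have hwd := (hY2 x hx.1 (hlt x hx)).fun_sub (hld.fun_mul hYd)
      have hw : ∀ᶠ z in 𝓝[>] x, 0 < Y' z - l z * Y z := by
        rcases hxw.lt_or_eq with h | h
        · exact (hwd.continuousAt.eventually (lt_mem_nhds (sub_pos.2 h))).filter_mono
            nhdsWithin_le_nhds
        · have hle := mul_le_of_differential_inequality ha₀ (ha_lb x hx.1 (hlt x hx))
            (hb_bd x hx.1 (hlt x hx)) hM hB hlx hquad hYx h.symm (hineq x hx.1 (hlt x hx))
          have := hwd.eventually_lt_nhdsGT (by nlinarith [mul_neg_of_neg_of_pos hl' hYx])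
          simpa only [h, sub_self] using this
      filter_upwards [hw, hYd.eventually_lt_nhdsGT hY'x] with z hz₁ hz₂
      exact ⟨(sub_pos.1 hz₁).le, hxY.trans hz₂.le⟩
  have hY_pos : ∀ s ∈ Icc 0 t, 0 < Y s := fun s hs => hY0.trans_le (hmain hs).2
  have hint : ∫ s in (0:ℝ)..t, l s ≤ Real.log (Y t) - Real.log (Y 0) := by
    refine intervalIntegral.integral_le_sub_of_hasDeriv_right_of_le (g' := fun s => Y' s / Y s) ht
      (hY_cont.log fun s hs => (hY_pos s hs).ne') (fun s hs => ?_)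
      (hl_cont.integrableOn_Icc) (fun s hs => ?_)
    · have hs := Ioo_subset_Icc_self hs
      exact ((hY1 s hs.1 (hlt s hs)).log (hY_pos s hs).ne').hasDerivWithinAt
    · have hs := Ioo_subset_Icc_self hs
      exact (le_div_iff₀ (hY_pos s hs)).2 (hmain hs).1
  have hYt := hY_pos t (right_mem_Icc.2 ht)
  rw [mul_comm, ← le_div_iff₀ hY0, ← Real.le_log_iff_exp_le (div_pos hYt hY0),
    Real.log_div hYt.ne' hY0.ne']
  exact hint
end

section
/- Let T ∈ (0,∞], let a : [0,T) → ℝ be continuously differentiable with a(t) > 0 and a'(t) > 0 for all t ∈ [0,T), let c > 0 and B ≥ 0. Suppose f : [0,T) → ℝ is twice continuously differentiable with f(t) ≥ 0, f'(t) ≥ 0, and f''(t) ≥ (c/a(t) + B²)·f(t) for all t ∈ [0,T). Then for all t ∈ [0,T), f'(t)² − (c/a(t) + B²)·f(t)² ≥ f'(0)² − (c/a(0) + B²)·f(0)². -/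
/-- The derivative of the energy `f'² - (c / a + b) f²` of a solution of a second order equation. -/
theorem hasDerivAt_sq_sub_div_add_mul_sq {a f f' : ℝ → ℝ} {a' f'' c b t : ℝ}
    (ha : HasDerivAt a a' t) (ha0 : a t ≠ 0) (hf : HasDerivAt f (f' t) t)
    (hf' : HasDerivAt f' f'' t) :
    HasDerivAt (fun s => f' s ^ 2 - (c / a s + b) * f s ^ 2)
      (2 * f' t * (f'' - (c / a t + b) * f t) + c * a' / a t ^ 2 * f t ^ 2) t := by
  refine ((hf'.fun_pow 2).fun_sub
    ((((hasDerivAt_const t c).fun_div ha ha0).add_const b).fun_mul (hf.fun_pow 2))).congr_deriv ?_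
  field_simp
  ring

/-- Key monotonicity step in the proof of Lemma 3.2: if `f ≥ 0`, `f' ≥ 0` and
`f'' ≥ (c/a + B²) f` with `a > 0` increasing, then
`f'(t)² - (c/a(t) + B²) f(t)²` is bounded below by its initial value. -/
theorem stmt_4 (T : EReal) (hT : 0 < T)
    (a a' f f' f'' : ℝ → ℝ) (c B : ℝ) (hc : 0 < c) (hB : 0 ≤ B)
    (ha_deriv : ∀ t : ℝ, 0 ≤ t → (t : EReal) < T → HasDerivAt a (a' t) t)
    (ha'_cont : ContinuousOn a' {t : ℝ | 0 ≤ t ∧ (t : EReal) < T})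
    (ha_pos : ∀ t : ℝ, 0 ≤ t → (t : EReal) < T → 0 < a t)
    (ha'_pos : ∀ t : ℝ, 0 ≤ t → (t : EReal) < T → 0 < a' t)
    (hf1 : ∀ t : ℝ, 0 ≤ t → (t : EReal) < T → HasDerivAt f (f' t) t)
    (hf2 : ∀ t : ℝ, 0 ≤ t → (t : EReal) < T → HasDerivAt f' (f'' t) t)
    (hf''_cont : ContinuousOn f'' {t : ℝ | 0 ≤ t ∧ (t : EReal) < T})
    (hf_nonneg : ∀ t : ℝ, 0 ≤ t → (t : EReal) < T → 0 ≤ f t)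
    (hf'_nonneg : ∀ t : ℝ, 0 ≤ t → (t : EReal) < T → 0 ≤ f' t)
    (hf''_ge : ∀ t : ℝ, 0 ≤ t → (t : EReal) < T →
      (c / a t + B ^ 2) * f t ≤ f'' t) :
    ∀ t : ℝ, 0 ≤ t → (t : EReal) < T →
      f' 0 ^ 2 - (c / a 0 + B ^ 2) * f 0 ^ 2 ≤
        f' t ^ 2 - (c / a t + B ^ 2) * f t ^ 2 := by
  intro t ht htT
  have hlt : ∀ s ∈ Set.Icc 0 t, (s : EReal) < T := fun s hs =>
    (EReal.coe_le_coe_iff.2 hs.2).trans_lt htT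
  have hderiv : ∀ s ∈ Set.Icc 0 t, HasDerivAt (fun s => f' s ^ 2 - (c / a s + B ^ 2) * f s ^ 2)
      (2 * f' s * (f'' s - (c / a s + B ^ 2) * f s) + c * a' s / a s ^ 2 * f s ^ 2) s :=
    fun s hs => hasDerivAt_sq_sub_div_add_mul_sq (ha_deriv s hs.1 (hlt s hs))
      (ha_pos s hs.1 (hlt s hs)).ne' (hf1 s hs.1 (hlt s hs)) (hf2 s hs.1 (hlt s hs))
  refine monotoneOn_of_hasDerivWithinAt_nonneg (convex_Icc 0 t)
    (fun s hs => (hderiv s hs).continuousAt.continuousWithinAt)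
    (fun s hs => (hderiv s (interior_subset hs)).hasDerivWithinAt) (fun s hs => ?_)
    (Set.left_mem_Icc.2 ht) (Set.right_mem_Icc.2 ht) ht
  have hs' := interior_subset hs
  have hf's := hf'_nonneg s hs'.1 (hlt s hs')
  have hf''s := sub_nonneg.2 (hf''_ge s hs'.1 (hlt s hs'))
  have ha's := ha'_pos s hs'.1 (hlt s hs')
  positivity
end

section
/- Let T ∈ (0,∞], let a : [0,T) → ℝ be continuous with a₀ ≤ a(t) ≤ a₁ for all t ∈ [0,T) and constants 0 < a₀ ≤ a₁, let b : [0,T) → ℝ be continuous with |b(t)| ≤ M for all t and some M ≥ 0, and let c > 0. Suppose Y : [0,T) → ℝ is twice continuously differentiable and satisfies a(t)·Y''(t) + b(t)·Y'(t) − c·Y(t) ≥ 0 for all t ∈ [0,T), with Y(0) > 0 and Y'(0) > 0. Then there exist constants C > 0 and μ > 0 such that Y(t) ≥ C·e^{μt} for all t ∈ [0,T). -/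
open Set Filter Topology

/-- A differential Grönwall lower bound: `Y' ≥ μ Y` forces `Y s ≥ Y 0 * exp (μ s)`. -/
lemma mul_exp_le_of_mul_le_deriv {Y Y' : ℝ → ℝ} {μ s : ℝ} (hs : 0 ≤ s)
    (hY : ∀ t ∈ Icc 0 s, HasDerivAt Y (Y' t) t)
    (hμ : ∀ t ∈ Ioo 0 s, μ * Y t ≤ Y' t) :
    Y 0 * Real.exp (μ * s) ≤ Y s := by
  have hder : ∀ t ∈ Icc 0 s, HasDerivAt (fun t => Y t * Real.exp (-(μ * t)))
      ((Y' t - μ * Y t) * Real.exp (-(μ * t))) t := fun t ht => by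
    have hexp : HasDerivAt (fun t : ℝ => Real.exp (-(μ * t)))
        (Real.exp (-(μ * t)) * -(μ * 1)) t := (((hasDerivAt_id t).const_mul μ).neg).exp
    exact ((hY t ht).mul hexp).congr_deriv (by ring)
  have hmono : MonotoneOn (fun t => Y t * Real.exp (-(μ * t))) (Icc 0 s) := by
    refine monotoneOn_of_hasDerivWithinAt_nonneg (convex_Icc 0 s)
      (fun t ht => (hder t ht).continuousAt.continuousWithinAt)
      (fun t ht => (hder t (interior_subset ht)).hasDerivWithinAt) fun t ht => ?_
    rw [interior_Icc] at ht
    exact mul_nonneg (sub_nonneg.2 (hμ t ht)) (Real.exp_pos _).le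
  have h := hmono (left_mem_Icc.2 hs) (right_mem_Icc.2 hs) hs
  simp only [mul_zero, neg_zero, Real.exp_zero, mul_one] at h
  calc Y 0 * Real.exp (μ * s)
      ≤ Y s * Real.exp (-(μ * s)) * Real.exp (μ * s) :=
        mul_le_mul_of_nonneg_right h (Real.exp_pos _).le
    _ = Y s := by rw [mul_assoc, ← Real.exp_add, neg_add_cancel, Real.exp_zero, mul_one]

/-- A function that is positive at `0` stays positive on `[0, s]` if its derivative is positive
at any first zero. -/
lemma pos_of_deriv_pos_at_first_zero {W W' : ℝ → ℝ} {s : ℝ}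
    (hW : ∀ t ∈ Icc 0 s, HasDerivAt W (W' t) t) (hW0 : 0 < W 0)
    (hfirst : ∀ t ∈ Icc 0 s, (∀ r ∈ Ico 0 t, 0 < W r) → W t = 0 → 0 < W' t) :
    ∀ t ∈ Icc 0 s, 0 < W t := by
  by_contra! ⟨t₁, ht₁, hWt₁⟩
  have hcont : ContinuousOn W (Icc 0 s) :=
    fun t ht => (hW t ht).continuousAt.continuousWithinAt
  have hcompact : IsCompact (Icc 0 s ∩ W ⁻¹' Iic 0) :=
    isCompact_Icc.of_isClosed_subset (hcont.preimage_isClosed_of_isClosed isClosed_Icc isClosed_Iic)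
      inter_subset_left
  obtain ⟨τ, ⟨hτ, hWτ⟩, hleast⟩ := hcompact.exists_isLeast ⟨t₁, ht₁, hWt₁⟩
  have hWτ : W τ ≤ 0 := hWτ
  have hpos : ∀ r ∈ Ico 0 τ, 0 < W r := fun r hr => by
    by_contra! hr'
    exact hr.2.not_ge (hleast ⟨⟨hr.1, hr.2.le.trans hτ.2⟩, hr'⟩)
  have hτ0 : 0 < τ := hτ.1.lt_of_ne fun h => hWτ.not_gt (h ▸ hW0)
  have hleft : ∀ᶠ r in 𝓝[<] τ, r ∈ Ioo 0 τ := Ioo_mem_nhdsLT hτ0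
  have hzero : W τ = 0 := hWτ.antisymm <|
    ge_of_tendsto ((hW τ hτ).continuousAt.tendsto.mono_left nhdsWithin_le_nhds)
      (hleft.mono fun r hr => (hpos r ⟨hr.1.le, hr.2⟩).le)
  have hslope : ∀ᶠ r in 𝓝[<] τ, 0 < slope W τ r :=
    ((hasDerivAt_iff_tendsto_slope.1 (hW τ hτ)).eventually_const_lt
      (hfirst τ hτ hpos hzero)).filter_mono (nhdsWithin_mono _ fun r hr => ne_of_lt hr)
  obtain ⟨r, hr, hsr⟩ := (hleft.and hslope).exists
  rw [slope_def_field, hzero, sub_zero] at hsr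
  exact hsr.not_gt (div_neg_of_pos_of_neg (hpos r ⟨hr.1.le, hr.2⟩) (sub_neg.2 hr.2))

/-- Lemma 3.3 (L2): with `0 < a₀ ≤ a(t) ≤ a₁` and `|b| ≤ M`, solutions of
`a Y'' + b Y' - c Y ≥ 0` with positive initial data grow exponentially. -/
theorem stmt_5 (T : EReal) (hT : 0 < T)
    (a b Y Y' Y'' : ℝ → ℝ) (a₀ a₁ M c : ℝ) (ha₀ : 0 < a₀) (ha₀₁ : a₀ ≤ a₁)
    (hM : 0 ≤ M)
    (ha_cont : ContinuousOn a {t : ℝ | 0 ≤ t ∧ (t : EReal) < T})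
    (ha_bd : ∀ t : ℝ, 0 ≤ t → (t : EReal) < T → a₀ ≤ a t ∧ a t ≤ a₁)
    (hb_cont : ContinuousOn b {t : ℝ | 0 ≤ t ∧ (t : EReal) < T})
    (hb_bd : ∀ t : ℝ, 0 ≤ t → (t : EReal) < T → |b t| ≤ M)
    (hc : 0 < c)
    (hY1 : ∀ t : ℝ, 0 ≤ t → (t : EReal) < T → HasDerivAt Y (Y' t) t)
    (hY2 : ∀ t : ℝ, 0 ≤ t → (t : EReal) < T → HasDerivAt Y' (Y'' t) t)
    (hY''_cont : ContinuousOn Y'' {t : ℝ | 0 ≤ t ∧ (t : EReal) < T})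
    (hineq : ∀ t : ℝ, 0 ≤ t → (t : EReal) < T →
      0 ≤ a t * Y'' t + b t * Y' t - c * Y t)
    (hY0 : 0 < Y 0) (hY'0 : 0 < Y' 0) :
    ∃ C : ℝ, 0 < C ∧ ∃ μ : ℝ, 0 < μ ∧
      ∀ t : ℝ, 0 ≤ t → (t : EReal) < T → C * Real.exp (μ * t) ≤ Y t := by
  have hY'0_div : 0 < Y' 0 / (2 * Y 0) := by positivity
  have ha₁M : 0 < a₁ + M := by linarith
  obtain ⟨μ, hμ, hμY, hμ1, hμc⟩ : ∃ μ : ℝ, 0 < μ ∧ μ * Y 0 < Y' 0 ∧ μ ≤ 1 ∧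
      (a₁ + M) * μ < c := by
    refine ⟨min (Y' 0 / (2 * Y 0)) (min 1 (c / (2 * (a₁ + M)))), by positivity, ?_,
      (min_le_right _ _).trans (min_le_left _ _), ?_⟩
    · refine (mul_le_mul_of_nonneg_right (min_le_left _ _) hY0.le).trans_lt ?_
      field_simp
      linarith
    · refine (mul_le_mul_of_nonneg_left
        ((min_le_right _ _).trans (min_le_right _ _)) ha₁M.le).trans_lt ?_
      field_simp
      linarith
  refine ⟨Y 0, hY0, μ, hμ, fun s hs hsT => ?_⟩
  have hdom : ∀ {t : ℝ}, t ∈ Icc 0 s → (t : EReal) < T := fun ht =>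
    (EReal.coe_le_coe_iff.2 ht.2).trans_lt hsT
  have hpos : ∀ t ∈ Icc 0 s, 0 < Y' t - μ * Y t := by
    refine pos_of_deriv_pos_at_first_zero (W := fun t => Y' t - μ * Y t)
      (W' := fun t => Y'' t - μ * Y' t)
      (fun t ht => (hY2 t ht.1 (hdom ht)).sub ((hY1 t ht.1 (hdom ht)).const_mul μ))
      (sub_pos.2 hμY) fun t ht hlt hzero => ?_
    have hYt : 0 < Y t := (mul_pos hY0 (Real.exp_pos _)).trans_le <|
      mul_exp_le_of_mul_le_deriv ht.1
        (fun r hr => hY1 r hr.1 (hdom ⟨hr.1, hr.2.trans ht.2⟩))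
        (fun r hr => (sub_pos.1 (hlt r ⟨hr.1.le, hr.2⟩)).le)
    obtain ⟨hat₀, hat₁⟩ := ha_bd t ht.1 (hdom ht)
    have hbt := (abs_le.1 (hb_bd t ht.1 (hdom ht))).2
    have hY't : Y' t = μ * Y t := sub_eq_zero.1 hzero
    have hsmall : a t * μ ^ 2 + b t * μ < c := by
      have h₁ : a t * μ ^ 2 ≤ a₁ * μ := by
        have : μ ^ 2 ≤ μ := by nlinarith
        exact mul_le_mul hat₁ this (sq_nonneg μ) (by linarith)
      have h₂ := mul_le_mul_of_nonneg_right hbt hμ.le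
      linarith
    have hq := hineq t ht.1 (hdom ht)
    have hstrict := mul_lt_mul_of_pos_right hsmall hYt
    rw [hY't] at hq ⊢
    refine pos_of_mul_pos_right (a := a t) ?_ (by linarith)
    linarith
  exact mul_exp_le_of_mul_le_deriv hs (fun t ht => hY1 t ht.1 (hdom ht))
    (fun t ht => (sub_pos.1 (hpos t ⟨ht.1.le, ht.2.le⟩)).le)
end

section
/- Let T ∈ (0,∞], β ≥ 0 and γ > 0, and let λ₊ > 0 > λ₋ be the two roots of λ² + βλ − γ = 0, i.e., λ_± = (−β ± √(β² + 4γ))/2. Suppose Y : [0,T) → ℝ is twice continuously differentiable with Y''(t) + β·Y'(t) − γ·Y(t) ≥ 0 for all t ∈ [0,T), Y(0) > 0 and Y'(0) > 0, and set Z₀ = Y'(0) − λ₋·Y(0) > 0. Then for all t ∈ [0,T), Y(t) ≥ (Z₀/(λ₊ − λ₋))·(e^{λ₊ t} − e^{λ₋ t}) + Y(0)·e^{λ₋ t}. -/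
/-- A differential inequality `a f ≤ f'` on `[0, t]` implies exponential growth of `f`. -/
theorem mul_exp_le_of_mul_le_hasDerivAt {f f' : ℝ → ℝ} {a t : ℝ} (ht : 0 ≤ t)
    (hf : ∀ s ∈ Set.Icc 0 t, HasDerivAt f (f' s) s)
    (h : ∀ s ∈ Set.Icc 0 t, a * f s ≤ f' s) :
    f 0 * Real.exp (a * t) ≤ f t := by
  have hd : ∀ s ∈ Set.Icc 0 t, HasDerivAt (fun s => f s * Real.exp (-(a * s)))
      ((f' s - a * f s) * Real.exp (-(a * s))) s := fun s hs =>
    ((hf s hs).mul ((hasDerivAt_id s).const_mul a).neg.exp).congr_deriv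
      (by simp only [id, Pi.neg_apply]; ring)
  have hmono : MonotoneOn (fun s => f s * Real.exp (-(a * s))) (Set.Icc 0 t) := by
    refine monotoneOn_of_hasDerivWithinAt_nonneg (convex_Icc 0 t)
      (fun s hs => (hd s hs).continuousAt.continuousWithinAt)
      (fun s hs => (hd s (interior_subset hs)).hasDerivWithinAt) fun s hs => ?_
    exact mul_nonneg (sub_nonneg.2 (h s (interior_subset hs))) (Real.exp_pos _).le
  have h0 : f 0 ≤ f t * Real.exp (-(a * t)) := by
    simpa using hmono ⟨le_rfl, ht⟩ ⟨ht, le_rfl⟩ ht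
  rwa [Real.exp_neg, ← div_eq_mul_inv, le_div_iff₀ (Real.exp_pos _)] at h0

/-- Explicit lower bound from the proof of Lemma 3.3: with
`λ± = (-β ± √(β² + 4γ))/2` and `Z₀ = Y'(0) - λ₋ Y(0)`,
`Y(t) ≥ (Z₀/(λ₊ - λ₋))(e^{λ₊ t} - e^{λ₋ t}) + Y(0) e^{λ₋ t}`. -/
theorem stmt_6 (T : EReal) (hT : 0 < T) (β γ lp lm Z₀ : ℝ)
    (hβ : 0 ≤ β) (hγ : 0 < γ)
    (hlp : lp = (-β + Real.sqrt (β ^ 2 + 4 * γ)) / 2)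
    (hlm : lm = (-β - Real.sqrt (β ^ 2 + 4 * γ)) / 2)
    (Y Y' Y'' : ℝ → ℝ)
    (hY1 : ∀ t : ℝ, 0 ≤ t → (t : EReal) < T → HasDerivAt Y (Y' t) t)
    (hY2 : ∀ t : ℝ, 0 ≤ t → (t : EReal) < T → HasDerivAt Y' (Y'' t) t)
    (hY''_cont : ContinuousOn Y'' {t : ℝ | 0 ≤ t ∧ (t : EReal) < T})
    (hineq : ∀ t : ℝ, 0 ≤ t → (t : EReal) < T →
      0 ≤ Y'' t + β * Y' t - γ * Y t)
    (hY0 : 0 < Y 0) (hY'0 : 0 < Y' 0)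
    (hZ₀ : Z₀ = Y' 0 - lm * Y 0) :
    ∀ t : ℝ, 0 ≤ t → (t : EReal) < T →
      Z₀ / (lp - lm) * (Real.exp (lp * t) - Real.exp (lm * t)) +
        Y 0 * Real.exp (lm * t) ≤ Y t := by
  intro t ht htT
  have hlt : ∀ s ≤ t, (s : EReal) < T := fun s hs =>
    (EReal.coe_le_coe_iff.2 hs).trans_lt htT
  have hsqrt : 0 < √(β ^ 2 + 4 * γ) := Real.sqrt_pos.2 (by positivity)
  have hsq : √(β ^ 2 + 4 * γ) ^ 2 = β ^ 2 + 4 * γ := Real.sq_sqrt (by positivity)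
  have hgap : 0 < lp - lm := by rw [hlp, hlm]; linarith
  have hsum : β = -(lp + lm) := by rw [hlp, hlm]; ring
  have hprod : γ = -(lp * lm) := by rw [hlp, hlm]; linear_combination -hsq / 4
  have hZ : ∀ s, 0 ≤ s → s ≤ t → Z₀ * Real.exp (lp * s) ≤ Y' s - lm * Y s := by
    intro s hs hst
    rw [hZ₀]
    refine mul_exp_le_of_mul_le_hasDerivAt (f := fun r => Y' r - lm * Y r)
      (f' := fun r => Y'' r - lm * Y' r) hs
      (fun r hr => (hY2 r hr.1 (hlt r (hr.2.trans hst))).sub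
        ((hY1 r hr.1 (hlt r (hr.2.trans hst))).const_mul lm)) fun r hr => ?_
    have hr' := hineq r hr.1 (hlt r (hr.2.trans hst))
    rw [hsum, hprod] at hr'
    linarith
  set c := Z₀ / (lp - lm)
  have hcZ : c * (lp - lm) = Z₀ := div_mul_cancel₀ _ hgap.ne'
  have hW := mul_exp_le_of_mul_le_hasDerivAt (a := lm)
    (f := fun r => Y r - c * Real.exp (lp * r))
    (f' := fun r => Y' r - c * (Real.exp (lp * r) * (lp * 1))) ht
    (fun r hr => (hY1 r hr.1 (hlt r hr.2)).sub
      (((hasDerivAt_id r).const_mul lp).exp.const_mul c)) fun r hr => by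
        have hr' := hZ r hr.1 hr.2
        rw [← hcZ] at hr'
        linarith
  simp only [mul_zero, Real.exp_zero, mul_one] at hW
  linarith
end

section
/- Let T ∈ (0,∞], let a : [0,T) → ℝ be continuous with a₀ ≤ a(t) ≤ a₁ for all t ∈ [0,T) and constants 0 < a₀ ≤ a₁, let b : [0,T) → ℝ be continuous with K := ∫₀^∞ |b(s)|/a(s) ds < ∞ (extending b by zero beyond T if T < ∞), and let c > 0. Set μ = √((21c/(40a₁))·e^{−K}). Suppose Y : [0,T) → ℝ is twice continuously differentiable and satisfies a(t)·Y''(t) + b(t)·Y'(t) − c·Y(t) ≥ 0 for all t ∈ [0,T), with Y(0) > 0 and Y'(0) > 0. Then Y(t) ≥ (4/7)·Y(0)·e^{μt} for all t ∈ [0,T). -/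
open Set

/-- A function with nonnegative derivative inside an interval does not decrease across it. -/
lemma le_of_hasDerivAt_nonneg {f f' : ℝ → ℝ} {x y : ℝ} (hxy : x ≤ y)
    (hf : ∀ s ∈ Icc x y, HasDerivAt f (f' s) s) (hf' : ∀ s ∈ Ioo x y, 0 ≤ f' s) :
    f x ≤ f y := by
  have hmono : MonotoneOn f (Icc x y) := by
    refine monotoneOn_of_deriv_nonneg (convex_Icc x y)
      (fun s hs => (hf s hs).continuousAt.continuousWithinAt) ?_ ?_
    · intro s hs
      exact (hf s (interior_subset hs)).differentiableAt.differentiableWithinAt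
    · intro s hs
      rw [(hf s (interior_subset hs)).deriv]
      exact hf' s (by rwa [interior_Icc] at hs)
  exact hmono (left_mem_Icc.2 hxy) (right_mem_Icc.2 hxy) hxy

/-- A continuous function on a compact interval is the derivative there of its primitive. -/
lemma exists_hasDerivAt_of_continuousOn_Icc {g : ℝ → ℝ} {t : ℝ} (ht : 0 ≤ t)
    (hg : ContinuousOn g (Icc 0 t)) :
    ∃ G : ℝ → ℝ, (∀ s ∈ Icc 0 t, G s = ∫ r in (0 : ℝ)..s, g r) ∧
      ∀ s ∈ Icc 0 t, HasDerivAt G (g s) s := by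
  have hcont : Continuous (IccExtend ht ((Icc 0 t).domRestrict g)) :=
    hg.domRestrict.Icc_extend'
  have heq : ∀ s ∈ Icc 0 t, IccExtend ht ((Icc 0 t).domRestrict g) s = g s := fun s hs => by
    rw [IccExtend_of_mem ht _ hs, domRestrict_apply]
  refine ⟨fun s => ∫ r in (0 : ℝ)..s, IccExtend ht ((Icc 0 t).domRestrict g) r, ?_, ?_⟩
  · intro s hs
    refine intervalIntegral.integral_congr fun r hr => ?_
    rw [uIcc_of_le hs.1] at hr
    exact heq r ⟨hr.1, hr.2.trans hs.2⟩
  · intro s hs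
    have := hcont.integral_hasStrictDerivAt 0 s
    rw [heq s hs] at this
    exact this.hasDerivAt

/-- Hyperbolic-cosine growth of the first component `Y` of a cooperative pair of first-order
differential inequalities. -/
lemma cosh_le_of_system {Y Y' G G' : ℝ → ℝ} {ν t : ℝ} (ht : 0 ≤ t) (hν : 0 < ν)
    (hY : ∀ s ∈ Icc 0 t, HasDerivAt Y (Y' s) s) (hG : ∀ s ∈ Icc 0 t, HasDerivAt G (G' s) s)
    (hYG : ∀ s ∈ Icc 0 t, G s ≤ Y' s) (hGY : ∀ s ∈ Icc 0 t, ν ^ 2 * Y s ≤ G' s)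
    (hG0 : 0 ≤ G 0) : Y 0 * Real.cosh (ν * t) ≤ Y t := by
  have hexp : ∀ k s : ℝ, HasDerivAt (fun r => Real.exp (k * r)) (Real.exp (k * s) * k) s :=
    fun k s => by simpa using ((hasDerivAt_id s).const_mul k).exp
  have hsum : ∀ s ∈ Icc 0 t, ν * Y 0 * Real.exp (ν * s) ≤ ν * Y s + G s := by
    intro s hs
    have hsub : ∀ r ∈ Icc 0 s, r ∈ Icc 0 t := fun r hr => ⟨hr.1, hr.2.trans hs.2⟩
    have h := le_of_hasDerivAt_nonneg hs.1
      (fun r hr => (hexp (-ν) r).mul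
        (((hY r (hsub r hr)).const_mul ν).add (hG r (hsub r hr))))
      (fun r hr => by
        have hr' := hsub r (Ioo_subset_Icc_self hr)
        have h1 := mul_le_mul_of_nonneg_left (hYG r hr') hν.le
        have h2 := hGY r hr'
        have h3 := mul_nonneg (Real.exp_pos (-ν * r)).le
          (show 0 ≤ ν * Y' r + G' r - ν * (ν * Y r + G r) by nlinarith)
        simp only [Pi.add_apply]
        linarith)
    simp only [Pi.mul_apply, Pi.add_apply, mul_zero, Real.exp_zero, one_mul] at h
    have h4 := mul_le_mul_of_nonneg_left h (Real.exp_pos (ν * s)).le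
    rw [← mul_assoc, ← Real.exp_add, show ν * s + -ν * s = 0 by ring, Real.exp_zero,
      one_mul] at h4
    nlinarith [mul_nonneg (Real.exp_pos (ν * s)).le hG0]
  have h := le_of_hasDerivAt_nonneg ht
    (fun s hs => ((hexp ν s).mul (hY s hs)).sub ((hexp (2 * ν) s).const_mul (Y 0 / 2)))
    (fun s hs => by
      have hs' := Ioo_subset_Icc_self hs
      have h1 := hsum s hs'
      have h2 := hYG s hs'
      have h3 := mul_nonneg (Real.exp_pos (ν * s)).le
        (show 0 ≤ ν * Y s + Y' s - ν * Y 0 * Real.exp (ν * s) by linarith)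
      have h4 : Real.exp (2 * ν * s) = Real.exp (ν * s) * Real.exp (ν * s) := by
        rw [← Real.exp_add]; ring_nf
      rw [h4]
      linarith)
  simp only [Pi.mul_apply, Pi.sub_apply, mul_zero, Real.exp_zero, one_mul] at h
  have h4 : Real.exp (2 * ν * t) = Real.exp (ν * t) * Real.exp (ν * t) := by
    rw [← Real.exp_add]; ring_nf
  have h5 : Real.exp (-(ν * t)) * Real.exp (ν * t) = 1 := by
    rw [← Real.exp_add]; simp
  rw [Real.cosh_eq]
  refine le_of_mul_le_mul_left ?_ (Real.exp_pos (ν * t))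
  rw [h4] at h
  linear_combination h + Y 0 / 2 * h5

/-- If a damped second derivative of `Y` is nonnegative wherever `Y` is, and `Y` starts nonnegative
with positive slope, then its slope stays positive. -/
lemma deriv_pos_of_pos {Y Y' Y'' β B : ℝ → ℝ} {t : ℝ}
    (hY : ∀ s ∈ Icc 0 t, HasDerivAt Y (Y' s) s)
    (hY' : ∀ s ∈ Icc 0 t, HasDerivAt Y' (Y'' s) s)
    (hB : ∀ s ∈ Icc 0 t, HasDerivAt B (β s) s)
    (h : ∀ s ∈ Icc 0 t, 0 ≤ Y s → 0 ≤ Y'' s + β s * Y' s)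
    (h0 : 0 ≤ Y 0) (h0' : 0 < Y' 0) : ∀ s ∈ Icc 0 t, 0 < Y' s := by
  by_contra! hne
  obtain ⟨s, hs, hYs⟩ := hne
  have hcont : ContinuousOn Y' (Icc 0 t) := fun r hr => (hY' r hr).continuousAt.continuousWithinAt
  have hcomp : IsCompact (Icc 0 t ∩ Y' ⁻¹' Iic 0) :=
    isCompact_Icc.of_isClosed_subset (hcont.preimage_isClosed_of_isClosed isClosed_Icc isClosed_Iic)
      inter_subset_left
  obtain ⟨m, ⟨hm, hYm⟩, hmin⟩ := hcomp.exists_isLeast ⟨s, hs, hYs⟩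
  have hsub : ∀ r ∈ Icc 0 m, r ∈ Icc 0 t := fun r hr => ⟨hr.1, hr.2.trans hm.2⟩
  have hpos : ∀ r ∈ Ico 0 m, 0 < Y' r := by
    intro r hr
    by_contra! hle
    exact hr.2.not_ge (hmin ⟨hsub r ⟨hr.1, hr.2.le⟩, hle⟩)
  have hYnn : ∀ r ∈ Ioo 0 m, 0 ≤ Y r := by
    intro r hr
    refine h0.trans (le_of_hasDerivAt_nonneg hr.1.le
      (fun q hq => hY q (hsub q ⟨hq.1, hq.2.trans hr.2.le⟩)) fun q hq => ?_)
    exact (hpos q ⟨hq.1.le, hq.2.trans hr.2⟩).le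
  have hmono := le_of_hasDerivAt_nonneg hm.1
    (fun r hr => (hB r (hsub r hr)).exp.mul (hY' r (hsub r hr)))
    (fun r hr => by
      have := mul_nonneg (Real.exp_pos (B r)).le
        (h r (hsub r (Ioo_subset_Icc_self hr)) (hYnn r hr))
      linarith)
  simp only [Pi.mul_apply] at hmono
  have h1 := mul_pos (Real.exp_pos (B 0)) h0'
  have h2 := mul_nonpos_of_nonneg_of_nonpos (Real.exp_pos (B m)).le hYm
  linarith

lemma exp_le_cosh (x : ℝ) : 4 / 7 * Real.exp (3 / 4 * x) ≤ Real.cosh x := by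
  set u := Real.exp (x / 4) with hu
  have hupos : 0 < u := Real.exp_pos _
  have h3 : Real.exp (3 / 4 * x) = u ^ 3 := by
    rw [hu, ← Real.exp_nat_mul]; push_cast; ring_nf
  have h4 : Real.exp x = u ^ 4 := by
    rw [hu, ← Real.exp_nat_mul]; push_cast; ring_nf
  rw [Real.cosh_eq, Real.exp_neg, h3, h4]
  have hkey : 0 ≤ (u - 1) ^ 2 *
      (7 * u ^ 6 + 6 * u ^ 5 + 5 * u ^ 4 + 4 * u ^ 3 + 3 * u ^ 2 + 2 * u + 1) := by positivity
  refine le_of_mul_le_mul_left ?_ (pow_pos hupos 4)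
  have hinv : u ^ 4 * (u ^ 4)⁻¹ = 1 := mul_inv_cancel₀ (pow_pos hupos 4).ne'
  nlinarith

/-- Lemma 3.4 (L3): with `0 < a₀ ≤ a ≤ a₁`, `b/a` integrable on `(0,∞)`
(`b` extended by zero beyond `T`), and `μ = √((21c/(40 a₁)) e^{-K})` where
`K = ∫₀^∞ |b(s)|/a(s) ds`, every solution of `a Y'' + b Y' - c Y ≥ 0` with
positive initial data satisfies `Y(t) ≥ (4/7) Y(0) e^{μ t}`. -/
theorem stmt_7 (T : EReal) (hT : 0 < T)
    (a b Y Y' Y'' : ℝ → ℝ) (a₀ a₁ c K μ : ℝ) (ha₀ : 0 < a₀) (ha₀₁ : a₀ ≤ a₁)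
    (ha_cont : ContinuousOn a {t : ℝ | 0 ≤ t ∧ (t : EReal) < T})
    (ha_bd : ∀ t : ℝ, 0 ≤ t → (t : EReal) < T → a₀ ≤ a t ∧ a t ≤ a₁)
    (hb_cont : ContinuousOn b {t : ℝ | 0 ≤ t ∧ (t : EReal) < T})
    (hb_zero : ∀ t : ℝ, T ≤ (t : EReal) → b t = 0)
    (hb_int : MeasureTheory.IntegrableOn (fun s => |b s| / a s) (Set.Ioi (0:ℝ)))
    (hK : K = ∫ s in Set.Ioi (0:ℝ), |b s| / a s)
    (hμ : μ = Real.sqrt (21 * c / (40 * a₁) * Real.exp (-K)))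
    (hc : 0 < c)
    (hY1 : ∀ t : ℝ, 0 ≤ t → (t : EReal) < T → HasDerivAt Y (Y' t) t)
    (hY2 : ∀ t : ℝ, 0 ≤ t → (t : EReal) < T → HasDerivAt Y' (Y'' t) t)
    (hY''_cont : ContinuousOn Y'' {t : ℝ | 0 ≤ t ∧ (t : EReal) < T})
    (hineq : ∀ t : ℝ, 0 ≤ t → (t : EReal) < T →
      0 ≤ a t * Y'' t + b t * Y' t - c * Y t)
    (hY0 : 0 < Y 0) (hY'0 : 0 < Y' 0) :
    ∀ t : ℝ, 0 ≤ t → (t : EReal) < T →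
      4 / 7 * Y 0 * Real.exp (μ * t) ≤ Y t := by
  intro t ht htT
  have hdom : ∀ s ∈ Icc 0 t, 0 ≤ s ∧ (s : EReal) < T := fun s hs =>
    ⟨hs.1, (EReal.coe_le_coe_iff.2 hs.2).trans_lt htT⟩
  have hsub : Icc 0 t ⊆ {s : ℝ | 0 ≤ s ∧ (s : EReal) < T} := hdom
  have hapos : ∀ s ∈ Icc 0 t, 0 < a s := fun s hs =>
    ha₀.trans_le (ha_bd s (hdom s hs).1 (hdom s hs).2).1
  have hane : ∀ s ∈ Icc 0 t, a s ≠ 0 := fun s hs => (hapos s hs).ne'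
  have ha₁ : 0 < a₁ := ha₀.trans_le ha₀₁
  have hY1' : ∀ s ∈ Icc 0 t, HasDerivAt Y (Y' s) s := fun s hs =>
    hY1 s (hdom s hs).1 (hdom s hs).2
  have hY2' : ∀ s ∈ Icc 0 t, HasDerivAt Y' (Y'' s) s := fun s hs =>
    hY2 s (hdom s hs).1 (hdom s hs).2
  have hdiv : ∀ s ∈ Icc 0 t, c / a s * Y s ≤ Y'' s + b s / a s * Y' s := by
    intro s hs
    have h := div_nonneg (hineq s (hdom s hs).1 (hdom s hs).2) (hapos s hs).le
    have he : (a s * Y'' s + b s * Y' s - c * Y s) / a s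
        = Y'' s + b s / a s * Y' s - c / a s * Y s := by
      field_simp [hane s hs]
    linarith
  obtain ⟨B, -, hB⟩ := exists_hasDerivAt_of_continuousOn_Icc ht
    ((hb_cont.mono hsub).div (ha_cont.mono hsub) hane)
  obtain ⟨A, hA_eq, hA⟩ := exists_hasDerivAt_of_continuousOn_Icc ht
    ((hb_cont.mono hsub).abs.div (ha_cont.mono hsub) hane)
  have hY'pos : ∀ s ∈ Icc 0 t, 0 < Y' s :=
    deriv_pos_of_pos hY1' hY2' hB
      (fun s hs hYs => (mul_nonneg (div_pos hc (hapos s hs)).le hYs).trans (hdiv s hs))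
      hY0.le hY'0
  have hYpos : ∀ s ∈ Icc 0 t, 0 < Y s := fun s hs =>
    hY0.trans_le (le_of_hasDerivAt_nonneg hs.1
      (fun r hr => hY1' r ⟨hr.1, hr.2.trans hs.2⟩)
      fun r hr => (hY'pos r ⟨hr.1.le, hr.2.le.trans hs.2⟩).le)
  have hnn : ∀ s ∈ Ioi (0 : ℝ), 0 ≤ |b s| / a s := by
    intro s hs
    rcases lt_or_ge (s : EReal) T with hsT | hsT
    · exact div_nonneg (abs_nonneg _) (ha₀.le.trans (ha_bd s (mem_Ioi.1 hs).le hsT).1)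
    · simp [hb_zero s hsT]
  have hA_le : ∀ s ∈ Icc 0 t, A s ≤ K := by
    intro s hs
    rw [hA_eq s hs, hK, intervalIntegral.integral_of_le hs.1]
    exact MeasureTheory.setIntegral_mono_set hb_int
      (MeasureTheory.ae_restrict_of_forall_mem measurableSet_Ioi hnn)
      Ioc_subset_Ioi_self.eventuallyLE
  have hA_nn : ∀ s ∈ Icc 0 t, 0 ≤ A s := by
    intro s hs
    rw [hA_eq s hs, intervalIntegral.integral_of_le hs.1]
    exact MeasureTheory.setIntegral_nonneg measurableSet_Ioc fun r hr => hnn r hr.1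
  set ν := Real.sqrt (c / a₁ * Real.exp (-K)) with hν
  have hν2 : ν ^ 2 = c / a₁ * Real.exp (-K) := Real.sq_sqrt (by positivity)
  have hνpos : 0 < ν := Real.sqrt_pos.2 (by positivity)
  have hcosh : Y 0 * Real.cosh (ν * t) ≤ Y t := by
    refine cosh_le_of_system (G := fun s => Real.exp (-K) * (Real.exp (A s) * Y' s)) ht hνpos hY1'
      (fun s hs => ((hA s hs).exp.mul (hY2' s hs)).const_mul (Real.exp (-K))) ?_ ?_ ?_
    · intro s hs
      have h1 : Real.exp (-K) * Real.exp (A s) ≤ 1 := by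
        rw [← Real.exp_add, Real.exp_le_one_iff]
        linarith [hA_le s hs]
      have := mul_le_mul_of_nonneg_right h1 (hY'pos s hs).le
      linarith
    · intro s hs
      have habs : b s / a s * Y' s ≤ |b s| / a s * Y' s :=
        mul_le_mul_of_nonneg_right
          (div_le_div_of_nonneg_right (le_abs_self _) (hapos s hs).le) (hY'pos s hs).le
      have hca : c / a₁ * Y s ≤ c / a s * Y s :=
        mul_le_mul_of_nonneg_right
          (div_le_div_of_nonneg_left hc.le (hapos s hs) (ha_bd s (hdom s hs).1 (hdom s hs).2).2)
          (hYpos s hs).le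
      have h1 : c / a₁ * Y s ≤ Y'' s + |b s| / a s * Y' s := by linarith [hdiv s hs]
      have h2 : 0 ≤ c / a₁ * Y s := mul_nonneg (by positivity) (hYpos s hs).le
      have h3 : c / a₁ * Y s ≤ Real.exp (A s) * (Y'' s + |b s| / a s * Y' s) :=
        h1.trans (le_mul_of_one_le_left (h2.trans h1) (Real.one_le_exp (hA_nn s hs)))
      have h4 := mul_le_mul_of_nonneg_left h3 (Real.exp_pos (-K)).le
      rw [hν2]
      simp only [Pi.div_apply]
      linarith
    · positivity
  have hμν : μ ≤ 3 / 4 * ν := by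
    rw [hμ]
    refine Real.sqrt_le_iff.2 ⟨by positivity, ?_⟩
    rw [mul_pow, hν2]
    have hpos : 0 < c / a₁ * Real.exp (-K) := by positivity
    have : 21 * c / (40 * a₁) * Real.exp (-K) = 21 / 40 * (c / a₁ * Real.exp (-K)) := by
      field_simp
    rw [this]
    linarith
  calc 4 / 7 * Y 0 * Real.exp (μ * t)
      ≤ 4 / 7 * Y 0 * Real.exp (3 / 4 * (ν * t)) := by
        have := mul_le_mul_of_nonneg_right hμν ht
        exact mul_le_mul_of_nonneg_left (Real.exp_le_exp.2 (by linarith)) (by positivity)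
    _ = Y 0 * (4 / 7 * Real.exp (3 / 4 * (ν * t))) := by ring
    _ ≤ Y 0 * Real.cosh (ν * t) := by
        gcongr
        exact exp_le_cosh _
    _ ≤ Y t := hcosh
end

section
/- Let T ∈ (0,∞], let a : [0,T) → ℝ be continuous with a₀ ≤ a(t) ≤ a₁ for all t and constants 0 < a₀ ≤ a₁, let b : [0,T) → ℝ be continuous, let c > 0 and μ > 0, and set K := ∫₀^∞ |b(s)|/a(s) ds < ∞ (extending b by zero beyond T if T < ∞) and I(s) := ∫₀ˢ b(τ)/a(τ) dτ. Suppose Y : [0,T) → ℝ is twice continuously differentiable, satisfies a(s)·Y''(s) + b(s)·Y'(s) − c·Y(s) ≥ 0 for all s, Y(0) > 0, Y'(0) > 0, and let t ∈ [0,T) be such that Y(s) ≥ ½·Y(0)·e^{μs} for all s ∈ [0,t]. Then Y(t) ≥ Y(0)·(1 − e^{−K}·c/(2a₁μ²)) + e^{−K}·Y'(0)·t + e^{−K}·Y(0)·(c/(2a₁μ²))·(e^{μt} − μt). -/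
open Set MeasureTheory in
/-- The integral of `b / a` over a subinterval is at most the integral of `|b| / a` over the
half-line, provided that `|b| / a` is integrable and nonnegative there. -/
theorem intervalIntegral_le_integral_abs_div {g h : ℝ → ℝ} {r s : ℝ} (hr : 0 ≤ r) (hrs : r ≤ s)
    (hg : Continuous g) (hgh : ∀ x ∈ Ioc r s, |g x| = h x)
    (hh : IntegrableOn h (Ioi 0)) (h_nonneg : ∀ x ∈ Ioi (0 : ℝ), 0 ≤ h x) :
    ∫ x in r..s, g x ≤ ∫ x in Ioi (0 : ℝ), h x := by
  calc ∫ x in r..s, g x ≤ ∫ x in r..s, |g x| :=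
        intervalIntegral.integral_mono_on hrs (hg.intervalIntegrable _ _)
          (hg.abs.intervalIntegrable _ _) fun x _ => le_abs_self _
    _ = ∫ x in Ioc r s, h x := by
        rw [intervalIntegral.integral_of_le hrs]
        exact setIntegral_congr_fun measurableSet_Ioc hgh
    _ ≤ ∫ x in Ioi (0 : ℝ), h x := by
        refine setIntegral_mono_set hh ?_ (Filter.Eventually.of_forall ?_)
        · exact (ae_restrict_iff' measurableSet_Ioi).2 (Filter.Eventually.of_forall h_nonneg)
        · exact fun x hx => lt_of_le_of_lt hr hx.1

/-- A function with nonnegative derivative on `[p, q]` satisfies `f p ≤ f q`. -/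
theorem le_of_forall_hasDerivAt_nonneg {f f' : ℝ → ℝ} {p q : ℝ} (hpq : p ≤ q)
    (hf : ∀ x ∈ Set.Icc p q, HasDerivAt f (f' x) x) (hf' : ∀ x ∈ Set.Icc p q, 0 ≤ f' x) :
    f p ≤ f q := by
  refine monotoneOn_of_deriv_nonneg (convex_Icc p q)
    (fun x hx => (hf x hx).continuousAt.continuousWithinAt) ?_ ?_
    (Set.left_mem_Icc.2 hpq) (Set.right_mem_Icc.2 hpq) hpq
  · exact fun x hx => (hf x (interior_subset hx)).differentiableAt.differentiableWithinAt
  · intro x hx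
    rw [(hf x (interior_subset hx)).deriv]
    exact hf' x (interior_subset hx)

/-- First integration with the integrating factor `exp (∫ g)`: if `y' + g y ≥ C e^{μ r}` on `[0, s]`
and all integrals of `g` over `[r, s]` are at most `K`, then `y s` is bounded below. -/
theorem exp_neg_mul_le_of_linear_differential_inequality {g y y' : ℝ → ℝ} {s C μ K : ℝ}
    (hs : 0 ≤ s) (hC : 0 ≤ C) (hμ : 0 < μ) (hg : Continuous g)
    (hK : ∀ r ∈ Set.Icc 0 s, ∫ x in r..s, g x ≤ K)
    (hy : ∀ r ∈ Set.Icc 0 s, HasDerivAt y (y' r) r) (hy0 : 0 ≤ y 0)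
    (hineq : ∀ r ∈ Set.Icc 0 s, C * Real.exp (μ * r) ≤ y' r + g r * y r) :
    Real.exp (-K) * (y 0 + C / μ * (Real.exp (μ * s) - 1)) ≤ y s := by
  have hderiv : ∀ r : ℝ, HasDerivAt (fun r => Real.exp (-∫ x in r..s, g x))
      (Real.exp (-∫ x in r..s, g x) * g r) r := fun r => by
    have h := (intervalIntegral.integral_hasDerivAt_left (hg.intervalIntegrable r s)
      (hg.stronglyMeasurableAtFilter _ _) hg.continuousAt).neg.exp
    simpa using h
  have hE : ∀ r : ℝ, HasDerivAt (fun r => Real.exp (-K) * (C / μ * Real.exp (μ * r)))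
      (Real.exp (-K) * (C * Real.exp (μ * r))) r := fun r => by
    have h := ((((hasDerivAt_id r).const_mul μ).exp).const_mul (C / μ)).const_mul (Real.exp (-K))
    refine h.congr_deriv ?_
    simp only [id]
    field_simp
  have hle : ∀ r ∈ Set.Icc 0 s, Real.exp (-K) ≤ Real.exp (-∫ x in r..s, g x) :=
    fun r hr => Real.exp_le_exp.2 (neg_le_neg (hK r hr))
  have key := le_of_forall_hasDerivAt_nonneg hs
    (fun r hr => ((hderiv r).mul (hy r hr)).sub (hE r)) (fun r hr => by
      have h1 := mul_le_mul_of_nonneg_left (hineq r hr)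
        (Real.exp_pos (-∫ x in r..s, g x)).le
      have h2 := mul_le_mul_of_nonneg_right (hle r hr)
        (mul_nonneg hC (Real.exp_pos (μ * r)).le)
      linarith)
  have h0 := mul_le_mul_of_nonneg_right (hle 0 (Set.left_mem_Icc.2 hs)) hy0
  simp at key
  linarith

/-- Inequality (2.5) in the proof of Lemma 3.4: under the bootstrap hypothesis
`Y(s) ≥ ½ Y(0) e^{μ s}` on `[0,t]`,
`Y(t) ≥ Y(0)(1 - e^{-K} c/(2 a₁ μ²)) + e^{-K} Y'(0) t + e^{-K} Y(0) (c/(2 a₁ μ²))(e^{μ t} - μ t)`,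
where `K = ∫₀^∞ |b(s)|/a(s) ds`. -/
theorem stmt_8 (T : EReal) (hT : 0 < T)
    (a b Y Y' Y'' : ℝ → ℝ) (a₀ a₁ c μ K : ℝ) (ha₀ : 0 < a₀) (ha₀₁ : a₀ ≤ a₁)
    (hμ : 0 < μ)
    (ha_cont : ContinuousOn a {t : ℝ | 0 ≤ t ∧ (t : EReal) < T})
    (ha_bd : ∀ t : ℝ, 0 ≤ t → (t : EReal) < T → a₀ ≤ a t ∧ a t ≤ a₁)
    (hb_cont : ContinuousOn b {t : ℝ | 0 ≤ t ∧ (t : EReal) < T})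
    (hb_zero : ∀ t : ℝ, T ≤ (t : EReal) → b t = 0)
    (hb_int : MeasureTheory.IntegrableOn (fun s => |b s| / a s) (Set.Ioi (0:ℝ)))
    (hK : K = ∫ s in Set.Ioi (0:ℝ), |b s| / a s)
    (hc : 0 < c)
    (hY1 : ∀ s : ℝ, 0 ≤ s → (s : EReal) < T → HasDerivAt Y (Y' s) s)
    (hY2 : ∀ s : ℝ, 0 ≤ s → (s : EReal) < T → HasDerivAt Y' (Y'' s) s)
    (hY''_cont : ContinuousOn Y'' {s : ℝ | 0 ≤ s ∧ (s : EReal) < T})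
    (hineq : ∀ s : ℝ, 0 ≤ s → (s : EReal) < T →
      0 ≤ a s * Y'' s + b s * Y' s - c * Y s)
    (hY0 : 0 < Y 0) (hY'0 : 0 < Y' 0)
    (t : ℝ) (ht0 : 0 ≤ t) (htT : (t : EReal) < T)
    (hboot : ∀ s : ℝ, s ∈ Set.Icc 0 t → 1 / 2 * Y 0 * Real.exp (μ * s) ≤ Y s) :
    Y 0 * (1 - Real.exp (-K) * (c / (2 * a₁ * μ ^ 2))) +
      Real.exp (-K) * Y' 0 * t +
      Real.exp (-K) * Y 0 * (c / (2 * a₁ * μ ^ 2)) * (Real.exp (μ * t) - μ * t)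
      ≤ Y t := by
  have ha₁ : 0 < a₁ := ha₀.trans_le ha₀₁
  have hdom : ∀ s ∈ Set.Icc 0 t, 0 ≤ s ∧ (s : EReal) < T := fun s hs =>
    ⟨hs.1, (EReal.coe_le_coe_iff.2 hs.2).trans_lt htT⟩
  have ha_pos : ∀ s ∈ Set.Icc 0 t, 0 < a s := fun s hs =>
    ha₀.trans_le (ha_bd s (hdom s hs).1 (hdom s hs).2).1
  have hcont : ContinuousOn (fun s => b s / a s) (Set.Icc 0 t) :=
    (hb_cont.mono hdom).div (ha_cont.mono hdom) fun s hs => (ha_pos s hs).ne'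
  obtain ⟨g, hg, hgba⟩ : ∃ g : ℝ → ℝ, Continuous g ∧ ∀ s ∈ Set.Icc 0 t, g s = b s / a s :=
    ⟨Set.IccExtend ht0 (Set.domRestrict (Set.Icc 0 t) fun s => b s / a s),
      hcont.domRestrict.Icc_extend', fun s hs => Set.IccExtend_of_mem ht0 _ hs⟩
  have h_nonneg : ∀ s ∈ Set.Ioi (0 : ℝ), 0 ≤ |b s| / a s := fun s hs => by
    rcases lt_or_ge (s : EReal) T with h | h
    · exact div_nonneg (abs_nonneg _) (ha₀.le.trans (ha_bd s (le_of_lt hs) h).1)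
    · simp [hb_zero s h]
  have hgK : ∀ s ∈ Set.Icc 0 t, ∀ r ∈ Set.Icc 0 s, ∫ x in r..s, g x ≤ K := fun s hs r hr => by
    rw [hK]
    refine intervalIntegral_le_integral_abs_div hr.1 hr.2 hg (fun x hx => ?_) hb_int h_nonneg
    have hx' : x ∈ Set.Icc 0 t := ⟨hr.1.trans hx.1.le, hx.2.trans hs.2⟩
    rw [hgba x hx', abs_div, abs_of_pos (ha_pos x hx')]
  have hlow : ∀ s ∈ Set.Icc 0 t,
      c * Y 0 / (2 * a₁) * Real.exp (μ * s) ≤ Y'' s + g s * Y' s := fun s hs => by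
    have ha := ha_pos s hs
    have hI := hineq s (hdom s hs).1 (hdom s hs).2
    calc c * Y 0 / (2 * a₁) * Real.exp (μ * s)
        = c * (1 / 2 * Y 0 * Real.exp (μ * s)) / a₁ := by field_simp
      _ ≤ c * (1 / 2 * Y 0 * Real.exp (μ * s)) / a s :=
          div_le_div_of_nonneg_left (by positivity) ha (ha_bd s (hdom s hs).1 (hdom s hs).2).2
      _ ≤ c * Y s / a s := by gcongr; exact hboot s hs
      _ ≤ (a s * Y'' s + b s * Y' s) / a s := by gcongr; linarith
      _ = Y'' s + g s * Y' s := by rw [hgba s hs]; field_simp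
  have hY' : ∀ s ∈ Set.Icc 0 t, Real.exp (-K) *
      (Y' 0 + c * Y 0 / (2 * a₁) / μ * (Real.exp (μ * s) - 1)) ≤ Y' s := fun s hs =>
    have hsub : Set.Icc 0 s ⊆ Set.Icc 0 t := Set.Icc_subset_Icc_right hs.2
    exp_neg_mul_le_of_linear_differential_inequality hs.1 (by positivity) hμ hg (hgK s hs)
      (fun r hr => hY2 r (hdom r (hsub hr)).1 (hdom r (hsub hr)).2) hY'0.le
      (fun r hr => hlow r (hsub hr))
  have hP : ∀ s : ℝ, HasDerivAt (fun s => Real.exp (-K) *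
      (Y' 0 * s + c * Y 0 / (2 * a₁) / μ * (Real.exp (μ * s) / μ - s)))
      (Real.exp (-K) * (Y' 0 + c * Y 0 / (2 * a₁) / μ * (Real.exp (μ * s) - 1))) s := fun s => by
    have h := (((hasDerivAt_id s).const_mul (Y' 0)).add
      ((((((hasDerivAt_id s).const_mul μ).exp).div_const μ).sub (hasDerivAt_id s)).const_mul
        (c * Y 0 / (2 * a₁) / μ))).const_mul (Real.exp (-K))
    refine h.congr_deriv ?_
    simp only [id]
    field_simp
  have key := le_of_forall_hasDerivAt_nonneg ht0
    (fun s hs => (hY1 s (hdom s hs).1 (hdom s hs).2).sub (hP s))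
    (fun s hs => sub_nonneg.2 (hY' s hs))
  simp only [Pi.sub_apply, mul_zero, Real.exp_zero, zero_add, sub_zero] at key
  calc _ = Y 0 - Real.exp (-K) * (c * Y 0 / (2 * a₁) / μ * (1 / μ)) + Real.exp (-K) *
        (Y' 0 * t + c * Y 0 / (2 * a₁) / μ * (Real.exp (μ * t) / μ - t)) := by
        field_simp
        ring
    _ ≤ Y t := by linarith
end
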